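/- Let (T, n) be a quadratic transformation of a local regular domain (R, m), and suppose x ∈ R satisfies xT = mT. Then x ∈ m \ m² and T = S_p where S := R[m/x] and p := S ∩ n. -/

import Mathlib

set_option synthInstance.maxHeartbeats 1000000
set_option maxHeartbeats 2000000

open IsLocalRing

noncomputable section

/-- The ideal generated by the nonunits of a ring (the maximal ideal, if the ring is local). -/
def nuIdeal (A : Type*) [CommRing A] : Ideal A := Ideal.span {a : A | ¬ IsUnit a}

/-- A commutative ring is regular local if it is a Noetherian local ring whose maximal ideal
can be generated by `dim` elements. -/
def IsRegLoc (A : Type*) [CommRing A] : Prop :=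
  IsLocalRing A ∧ IsNoetherianRing A ∧
    ∃ s : Finset A, (Ideal.span (s : Set A) = nuIdeal A) ∧
      ((s.card : ℕ) : WithBot (WithTop ℕ)) = ringKrullDim A

variable (R : Type*) [CommRing R] [IsDomain R]

/-- The ring `A[m_A/x]` inside the fraction field (where `m_A` is the ideal generated by
the nonunits of `A`, i.e. the maximal ideal when `A` is local). -/
def S1 (A : Subalgebra R (FractionRing R)) (x : A) : Subalgebra R (FractionRing R) :=
  Algebra.adjoin R ((A : Set (FractionRing R)) ∪
    {z | ∃ a : A, a ∈ nuIdeal A ∧ z = (a : FractionRing R) / (x : FractionRing R)})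

/-- The localization of a subalgebra `S` of the fraction field at a prime `p`, realized as a
subalgebra of the fraction field: `S[(S \ p)⁻¹]`. -/
def locSub (S : Subalgebra R (FractionRing R)) (p : Ideal S) : Subalgebra R (FractionRing R) :=
  Algebra.adjoin R ((S : Set (FractionRing R)) ∪
    {z | ∃ s : S, s ∉ p ∧ z = (s : FractionRing R)⁻¹})

/-- `x`, viewed as an element of `A[m_A/x]`. -/
def xIn (A : Subalgebra R (FractionRing R)) (x : A) : S1 R A x :=
  ⟨(x : FractionRing R), Algebra.subset_adjoin (Or.inl x.2)⟩

/-- `B` is a (first) quadratic transform of `A`: there are `x ∈ m_A \ m_A²` and a prime ideal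
`p` of `S := A[m_A/x]` containing `x` such that `B = S_p`. -/
def QuadStep (A B : Subalgebra R (FractionRing R)) : Prop :=
  ∃ x : A, x ∈ nuIdeal A ∧ x ∉ (nuIdeal A) ^ 2 ∧
    ∃ p : Ideal (S1 R A x), p.IsPrime ∧ xIn R A x ∈ p ∧ B = locSub R (S1 R A x) p

theorem nuIdeal_eq_maximalIdeal (A : Type*) [CommRing A] [IsLocalRing A] :
    nuIdeal A = maximalIdeal A :=
  le_antisymm (Ideal.span_le.2 fun _ ha => ha) fun _ ha => Ideal.subset_span ha

section LocSub

variable {R}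

theorem le_locSub (S : Subalgebra R (FractionRing R)) (p : Ideal S) : S ≤ locSub R S p :=
  fun _ hz => Algebra.subset_adjoin (Or.inl hz)

theorem inv_mem_locSub {S : Subalgebra R (FractionRing R)} {p : Ideal S} {s : S} (hs : s ∉ p) :
    (s : FractionRing R)⁻¹ ∈ locSub R S p :=
  Algebra.subset_adjoin (Or.inr ⟨s, hs, rfl⟩)

theorem coe_ne_zero_of_notMem {A : Type*} [CommRing A] {S : Subalgebra A (FractionRing A)}
    {p : Ideal S} {s : S} (hs : s ∉ p) : (s : FractionRing A) ≠ 0 :=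
  fun h => hs ((Subtype.ext h : s = 0) ▸ p.zero_mem)

/-- Elements of the localization at a prime are fractions with denominator outside the prime. -/
theorem exists_eq_div_of_mem_locSub {S : Subalgebra R (FractionRing R)} {p : Ideal S}
    (hp : p.IsPrime) {z : FractionRing R} (hz : z ∈ locSub R S p) :
    ∃ f g : S, g ∉ p ∧ z = (f : FractionRing R) / (g : FractionRing R) := by
  have one_notMem : (1 : S) ∉ p := fun h => hp.ne_top ((Ideal.eq_top_iff_one p).2 h)
  induction hz using Algebra.adjoin_induction with
  | mem z hz =>
    rcases hz with hz | ⟨s, hs, rfl⟩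
    · exact ⟨⟨z, hz⟩, 1, one_notMem, by simp⟩
    · exact ⟨1, s, hs, by simp⟩
  | algebraMap r => exact ⟨algebraMap R S r, 1, one_notMem, by simp⟩
  | add a b _ _ ha hb =>
    obtain ⟨f, g, hg, rfl⟩ := ha
    obtain ⟨f', g', hg', rfl⟩ := hb
    refine ⟨f * g' + g * f', g * g', fun h => (hp.mem_or_mem h).elim hg hg', ?_⟩
    push_cast
    exact div_add_div _ _ (coe_ne_zero_of_notMem hg) (coe_ne_zero_of_notMem hg')
  | mul a b _ _ ha hb =>
    obtain ⟨f, g, hg, rfl⟩ := ha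
    obtain ⟨f', g', hg', rfl⟩ := hb
    refine ⟨f * f', g * g', fun h => (hp.mem_or_mem h).elim hg hg', ?_⟩
    push_cast
    exact div_mul_div_comm _ _ _ _

theorem isUnit_of_coe_inv_mem {T : Subalgebra R (FractionRing R)} {t : T}
    (h0 : (t : FractionRing R) ≠ 0) (h : (t : FractionRing R)⁻¹ ∈ T) : IsUnit t :=
  IsUnit.of_mul_eq_one ⟨_, h⟩ (Subtype.ext (mul_inv_cancel₀ h0))

theorem coe_inv_mem_of_isUnit {T : Subalgebra R (FractionRing R)} {t : T} (h : IsUnit t) :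
    (t : FractionRing R)⁻¹ ∈ T := by
  obtain ⟨u, hu⟩ := h.exists_right_inv
  have hu' : (t : FractionRing R) * u = 1 := congrArg Subtype.val hu
  exact inv_eq_of_mul_eq_one_right hu' ▸ u.2

theorem isUnit_of_coe_eq_div {S : Subalgebra R (FractionRing R)} {p : Ideal S}
    {t : locSub R S p} {f g : S} (hf : f ∉ p) (hg : g ∉ p)
    (ht : (t : FractionRing R) = (f : FractionRing R) / (g : FractionRing R)) : IsUnit t := by
  refine isUnit_of_coe_inv_mem ?_ ?_
  · rw [ht]
    exact div_ne_zero (coe_ne_zero_of_notMem hf) (coe_ne_zero_of_notMem hg)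
  · rw [ht, inv_div, div_eq_mul_inv]
    exact mul_mem (le_locSub S p g.2) (inv_mem_locSub hf)

theorem isLocalRing_locSub {S : Subalgebra R (FractionRing R)} {p : Ideal S} (hp : p.IsPrime) :
    IsLocalRing (locSub R S p) := by
  refine IsLocalRing.of_isUnit_or_isUnit_one_sub_self fun t => ?_
  obtain ⟨f, g, hg, ht⟩ := exists_eq_div_of_mem_locSub hp t.2
  by_cases hf : f ∈ p
  · right
    have hgf : g - f ∉ p := fun h => hg (by simpa using p.add_mem h hf)
    refine isUnit_of_coe_eq_div hgf hg ?_
    push_cast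
    rw [ht, sub_div, div_self (coe_ne_zero_of_notMem hg)]
  · exact Or.inl (isUnit_of_coe_eq_div hf hg ht)

theorem not_isUnit_of_mem {S : Subalgebra R (FractionRing R)} {p : Ideal S} (hp : p.IsPrime)
    {s : S} (hs : s ∈ p) {t : locSub R S p} (ht : (t : FractionRing R) = s) : ¬ IsUnit t := by
  intro h
  obtain ⟨u, hu⟩ := h.exists_right_inv
  have hu' : (t : FractionRing R) * u = 1 := congrArg Subtype.val hu
  obtain ⟨f, g, hg, hfg⟩ := exists_eq_div_of_mem_locSub hp u.2
  rw [ht, hfg, ← mul_div_assoc, div_eq_one_iff_eq (coe_ne_zero_of_notMem hg)] at hu'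
  have hsf : s * f = g := Subtype.ext hu'
  exact hg (hsf ▸ p.mul_mem_right f hs)

/-- A local overring `T` contains the localization of `S ≤ T` at the contraction of its maximal
ideal. -/
theorem locSub_comap_le {S T : Subalgebra R (FractionRing R)} [IsLocalRing T] (hle : S ≤ T) :
    locSub R S ((nuIdeal T).comap (Subalgebra.inclusion hle)) ≤ T := by
  refine Algebra.adjoin_le ?_
  rintro z (hz | ⟨s, hs, rfl⟩)
  · exact hle hz
  · rw [Ideal.mem_comap, nuIdeal_eq_maximalIdeal, IsLocalRing.mem_maximalIdeal,
      mem_nonunits_iff, not_not] at hs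
    exact coe_inv_mem_of_isUnit hs

/-- The localization of `S ≤ T` at the contraction of the maximal ideal of `T` contains the
inverses of those of its elements that are invertible in `T`. -/
theorem inv_mem_locSub_comap {S T : Subalgebra R (FractionRing R)} [IsLocalRing T] (hle : S ≤ T)
    {z : FractionRing R} (hz : z ∈ locSub R S ((nuIdeal T).comap (Subalgebra.inclusion hle)))
    (h0 : z ≠ 0) (hinv : z⁻¹ ∈ T) :
    z⁻¹ ∈ locSub R S ((nuIdeal T).comap (Subalgebra.inclusion hle)) := by
  have hp : ((nuIdeal T).comap (Subalgebra.inclusion hle)).IsPrime := by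
    rw [nuIdeal_eq_maximalIdeal]
    infer_instance
  obtain ⟨f, g, hg, rfl⟩ := exists_eq_div_of_mem_locSub hp hz
  have hf : f ∉ (nuIdeal T).comap (Subalgebra.inclusion hle) := by
    intro hf
    have hgf : g ∈ (nuIdeal T).comap (Subalgebra.inclusion hle) := by
      have hf0 : (f : FractionRing R) ≠ 0 := fun h => h0 (by simp [h])
      have h : Subalgebra.inclusion hle g = Subalgebra.inclusion hle f * ⟨_, hinv⟩ := by
        apply Subtype.ext
        change (g : FractionRing R) = f * (f / g : FractionRing R)⁻¹
        rw [inv_div, mul_div_cancel₀ _ hf0]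
      rw [Ideal.mem_comap, h]
      exact Ideal.mul_mem_right _ _ hf
    exact hg hgf
  rw [inv_div, div_eq_mul_inv]
  exact mul_mem (le_locSub _ _ g.2) (inv_mem_locSub hf)

end LocSub

theorem isUnit_algebraMap_bot_iff (A : Type*) [CommRing A] (r : A) :
    IsUnit (algebraMap A (⊥ : Subalgebra A (FractionRing A)) r) ↔ IsUnit r := by
  have h := MulEquiv.isUnit_map (Algebra.botEquivOfInjective
    (IsFractionRing.injective A (FractionRing A))) (x := algebraMap A _ r)
  rw [AlgEquiv.commutes] at h
  exact h.symm

theorem isLocalRing_bot (A : Type*) [CommRing A] [IsLocalRing A] :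
    IsLocalRing (⊥ : Subalgebra A (FractionRing A)) :=
  (Algebra.botEquivOfInjective
    (IsFractionRing.injective A (FractionRing A))).symm.toRingEquiv.isLocalRing

theorem algebraMap_mem_nuIdeal_bot_iff (A : Type*) [CommRing A] [IsLocalRing A] (r : A) :
    algebraMap A (⊥ : Subalgebra A (FractionRing A)) r ∈ nuIdeal (⊥ : Subalgebra A (FractionRing A))
      ↔ r ∈ maximalIdeal A := by
  have := isLocalRing_bot A
  rw [nuIdeal_eq_maximalIdeal, mem_maximalIdeal, mem_maximalIdeal, mem_nonunits_iff,
    mem_nonunits_iff, isUnit_algebraMap_bot_iff]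

/-- A quadratic transform `T` of a local domain `(R, m)` is local, and for some `r ∈ m` that is
not a unit of `T` it contains `m/r` and is generated by `m/r` under the ring operations and the
inversion of units of `T`. -/
theorem QuadStep.exists_generator {R : Type*} [CommRing R] [IsDomain R] [IsLocalRing R]
    {T : Subalgebra R (FractionRing R)} (hT : QuadStep R ⊥ T) :
    IsLocalRing T ∧ ∃ r ∈ maximalIdeal R, r ≠ 0 ∧ ¬ IsUnit (algebraMap R T r) ∧
      (∀ a ∈ maximalIdeal R,
        algebraMap R (FractionRing R) a / algebraMap R (FractionRing R) r ∈ T) ∧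
      ∀ U : Subalgebra R (FractionRing R),
        (∀ a ∈ maximalIdeal R,
          algebraMap R (FractionRing R) a / algebraMap R (FractionRing R) r ∈ U) →
        (∀ z ∈ U, z ≠ 0 → z⁻¹ ∈ T → z⁻¹ ∈ U) → T ≤ U := by
  obtain ⟨y, hy, hy2, p, hp, hyp, rfl⟩ := hT
  obtain ⟨r, hr⟩ := Algebra.mem_bot.1 y.2
  obtain rfl : algebraMap R (⊥ : Subalgebra R (FractionRing R)) r = y := Subtype.ext hr
  refine ⟨isLocalRing_locSub hp, r, (algebraMap_mem_nuIdeal_bot_iff R r).1 hy, ?_,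
    not_isUnit_of_mem hp hyp rfl, fun a ha => ?_, fun U hU hinv => ?_⟩
  · rintro rfl
    exact hy2 (by rw [map_zero]; exact zero_mem _)
  · exact le_locSub _ p (Algebra.subset_adjoin (Or.inr ⟨algebraMap R _ a,
      (algebraMap_mem_nuIdeal_bot_iff R a).2 ha, rfl⟩))
  · have S1_le : S1 R ⊥ (algebraMap R (⊥ : Subalgebra R (FractionRing R)) r) ≤ U := by
      refine Algebra.adjoin_le ?_
      rintro z (hz | ⟨a, ha, rfl⟩)
      · exact (bot_le : ⊥ ≤ U) hz
      · obtain ⟨b, hb⟩ := Algebra.mem_bot.1 a.2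
        obtain rfl : algebraMap R (⊥ : Subalgebra R (FractionRing R)) b = a := Subtype.ext hb
        exact hU b ((algebraMap_mem_nuIdeal_bot_iff R b).1 ha)
    refine Algebra.adjoin_le ?_
    rintro z (hz | ⟨s, hs, rfl⟩)
    · exact S1_le hz
    · exact hinv _ (S1_le s.2) (coe_ne_zero_of_notMem hs) (inv_mem_locSub hs)

/-- Let `(T, n)` be a quadratic transformation of a local regular domain
`(R, m)` (with `R` identified with the bottom subalgebra of its fraction field and `n` the
maximal ideal of `T`), and suppose `x ∈ R` satisfies `xT = mT`.  Then `x ∈ m \ m²` and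
`T = S_p`, where `S := R[m/x]` and `p := S ∩ n`. -/
theorem quadratic_transform_eq_of_generator
    (R : Type*) [CommRing R] [IsDomain R] [IsLocalRing R] (hreg : IsRegLoc R)
    (T : Subalgebra R (FractionRing R)) (hT : QuadStep R ⊥ T)
    (x : R)
    (hx : Ideal.span {algebraMap R T x} = Ideal.map (algebraMap R T) (maximalIdeal R))
    (S : Subalgebra R (FractionRing R))
    (hS : S = Algebra.adjoin R {z : FractionRing R | ∃ a ∈ maximalIdeal R,
      z = algebraMap R (FractionRing R) a / algebraMap R (FractionRing R) x}) :
    x ∈ maximalIdeal R ∧ x ∉ (maximalIdeal R) ^ 2 ∧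
    ∃ hle : S ≤ T,
      T = locSub R S ((nuIdeal T).comap (Subalgebra.inclusion hle)) := by
  obtain ⟨_, r, hrm, hr0, hru, hdiv, hgen⟩ := hT.exists_generator
  have hK : Function.Injective (algebraMap R (FractionRing R)) :=
    IsFractionRing.injective R (FractionRing R)
  have hrK : algebraMap R (FractionRing R) r ≠ 0 := (map_ne_zero_iff _ hK).2 hr0
  have hrT : algebraMap R T r ≠ 0 := fun h => hrK (congrArg Subtype.val h)
  have dvd_of_mem : ∀ a ∈ maximalIdeal R, algebraMap R T r ∣ algebraMap R T a := fun a ha =>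
    ⟨⟨_, hdiv a ha⟩, Subtype.ext (mul_div_cancel₀ _ hrK).symm⟩
  have map_le : Ideal.map (algebraMap R T) (maximalIdeal R) ≤ Ideal.span {algebraMap R T r} :=
    Ideal.map_le_iff_le_comap.2 fun a ha => Ideal.mem_span_singleton.2 (dvd_of_mem a ha)
  have x_dvd : ∀ a ∈ maximalIdeal R, algebraMap R T x ∣ algebraMap R T a := fun a ha =>
    Ideal.mem_span_singleton.1 (hx ▸ Ideal.mem_map_of_mem _ ha)
  have hxr : algebraMap R T x ∣ algebraMap R T r := x_dvd r hrm
  have r_dvd : algebraMap R T r ∣ algebraMap R T x :=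
    Ideal.mem_span_singleton.1 (map_le (hx ▸ Ideal.mem_span_singleton_self _))
  have hxm : x ∈ maximalIdeal R := fun h => hru (isUnit_of_dvd_unit r_dvd (h.map _))
  have hxK : algebraMap R (FractionRing R) x ≠ 0 := by
    intro h
    obtain ⟨c, hc⟩ := hxr
    rw [(map_eq_zero_iff _ hK).1 h, map_zero, zero_mul] at hc
    exact hrT hc
  have hle : S ≤ T := by
    rw [hS]
    refine Algebra.adjoin_le ?_
    rintro _ ⟨a, ha, rfl⟩
    obtain ⟨c, hc⟩ := x_dvd a ha
    have hc' : algebraMap R (FractionRing R) a = algebraMap R (FractionRing R) x * c :=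
      congrArg Subtype.val hc
    rw [hc', mul_div_cancel_left₀ _ hxK]
    exact c.2
  refine ⟨hxm, fun hx2 => hru ?_, hle, le_antisymm ?_ (locSub_comap_le hle)⟩
  · have hsq : algebraMap R T r * algebraMap R T r ∣ algebraMap R T x := by
      have hmap : Ideal.map (algebraMap R T) (maximalIdeal R ^ 2) ≤
          Ideal.span {algebraMap R T r} ^ 2 := by
        rw [Ideal.map_pow]
        exact Ideal.pow_right_mono map_le 2
      rw [← sq, ← Ideal.mem_span_singleton, ← Ideal.span_singleton_pow]
      exact hmap (Ideal.mem_map_of_mem _ hx2)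
    obtain ⟨c, hc⟩ := hsq.trans hxr
    refine IsUnit.of_mul_eq_one c (mul_left_cancel₀ hrT ?_)
    rw [mul_one, ← mul_assoc]
    exact hc.symm
  · have div_x_mem : ∀ a ∈ maximalIdeal R,
        algebraMap R (FractionRing R) a / algebraMap R (FractionRing R) x ∈ S := fun a ha =>
      hS ▸ Algebra.subset_adjoin ⟨a, ha, rfl⟩
    have x_div_r_mem : algebraMap R (FractionRing R) x / algebraMap R (FractionRing R) r ∈
        locSub R S ((nuIdeal T).comap (Subalgebra.inclusion hle)) := by
      rw [← inv_div]
      refine inv_mem_locSub_comap hle (le_locSub _ _ (div_x_mem r hrm)) (div_ne_zero hrK hxK) ?_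
      obtain ⟨c, hc⟩ := r_dvd
      have hc' : algebraMap R (FractionRing R) x = algebraMap R (FractionRing R) r * c :=
        congrArg Subtype.val hc
      rw [inv_div, hc', mul_div_cancel_left₀ _ hrK]
      exact c.2
    refine hgen _ (fun a ha => ?_) fun z hz h0 hinv => inv_mem_locSub_comap hle hz h0 hinv
    have h := mul_mem (le_locSub _ _ (div_x_mem a ha)) x_div_r_mem
    rwa [div_mul_div_cancel₀ hxK] at h

end
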